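/- Let p be an odd prime, let a be a p-integer with 1 ≤ ⟨a⟩_p < p/2, and set t = (a − ⟨a⟩_p)/p; assume t ≢ 0 (mod p). Then Σ_{k=0}^{p−1} C(a,k)·C(−1−a,k)·p/(k − a) ≡ ((2t+1)/t)·(−1)^{⟨a⟩_p − 1}·C(2⟨a⟩_p, ⟨a⟩_p) + 2·C(p − 1 − ⟨a⟩_p, ⟨a⟩_p) ≡ (−1)^{⟨a⟩_p − 1}·C(2⟨a⟩_p, ⟨a⟩_p)·( 1/t + 2p·(H_{2⟨a⟩_p} − H_{⟨a⟩_p}) ) (mod p²). -/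

import Mathlib

/-- A rational number is a `p`-integer if its denominator (in lowest terms)
is not divisible by `p`. -/
def isPInt (p : ℕ) (x : ℚ) : Prop := ¬ p ∣ x.den

/-- For `p`-integers `u, v`, `u ≡ v (mod p^k)` means `(u - v)/p^k` is a `p`-integer. -/
def pCong (p k : ℕ) (u v : ℚ) : Prop := isPInt p ((u - v) / (p : ℚ) ^ k)

/-- The generalized binomial coefficient `C(a, k) = a(a-1)⋯(a-k+1)/k!`. -/
def rchoose (a : ℚ) (k : ℕ) : ℚ := (∏ i ∈ Finset.range k, (a - i)) / (k.factorial : ℚ)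

/-- The subring of `ℚ` formed by the `p`-integers. -/
def pIntegers (p : ℕ) (hp : p.Prime) : Subring ℚ where
  carrier := {x | isPInt p x}
  mul_mem' {x y} hx hy h :=
    (hp.dvd_mul.1 (h.trans (Rat.mul_den_dvd x y))).elim hx hy
  add_mem' {x y} hx hy h :=
    (hp.dvd_mul.1 (h.trans (Rat.add_den_dvd x y))).elim hx hy
  one_mem' h := hp.one_lt.ne' (Nat.dvd_one.1 h)
  zero_mem' h := hp.one_lt.ne' (Nat.dvd_one.1 h)
  neg_mem' {x} hx h := hx (by simpa using h)

namespace pIntegers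

variable {p : ℕ} {hp : p.Prime}

theorem natCast_div_notMem {n : ℕ} (hn : ¬ p ∣ n) : (n / p : ℚ) ∉ pIntegers p hp := by
  intro h
  set y : ℚ := n / p with hy
  have hp0 : (p : ℚ) ≠ 0 := by exact_mod_cast hp.ne_zero
  have h1 : (n : ℚ) * y.den = p * y.num := by
    have h2 : y * y.den = y.num := Rat.mul_den_eq_num y
    have h3 : y * p = n := by rw [hy]; field_simp
    rw [← h2, ← h3]; ring
  have h4 : (n : ℤ) * y.den = p * y.num := by exact_mod_cast h1
  have h5 : (p : ℤ) ∣ ((n * y.den : ℕ) : ℤ) := ⟨y.num, by push_cast; exact h4⟩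
  exact (hp.dvd_mul.1 (Int.natCast_dvd_natCast.1 h5)).elim hn h

theorem inv_mem {x : ℚ} (hx : x ∈ pIntegers p hp) (hxp : x / p ∉ pIntegers p hp) :
    x⁻¹ ∈ pIntegers p hp := by
  have hp0 : (p : ℚ) ≠ 0 := by exact_mod_cast hp.ne_zero
  intro h
  have hx0 : x ≠ 0 := by
    rintro rfl
    exact hxp (by simp)
  have h1 : p ∣ x.num.natAbs := by
    simpa [Rat.den_inv, hx0] using h
  obtain ⟨m, hm⟩ := Int.natCast_dvd.2 h1
  apply hxp
  have h2 : x / p = m * (x.den : ℚ)⁻¹ := by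
    have h3 : x = x.num / x.den := (Rat.num_div_den x).symm
    have h4 : (x.den : ℚ) ≠ 0 := by exact_mod_cast x.den_ne_zero
    rw [hm] at h3
    push_cast at h3
    rw [eq_div_iff h4] at h3
    field_simp
    linarith
  rw [h2]
  refine mul_mem (intCast_mem _ m) ?_
  intro h5
  rw [Rat.inv_natCast_den_of_pos x.den_pos] at h5
  exact hx h5

theorem inv_mem_of_sub {x y : ℚ} {n : ℕ} (hn : ¬ p ∣ n) (hy : y ∈ pIntegers p hp)
    (hx : x = n + p * y) : x⁻¹ ∈ pIntegers p hp := by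
  have hp0 : (p : ℚ) ≠ 0 := by exact_mod_cast hp.ne_zero
  refine inv_mem (hx ▸ add_mem (natCast_mem _ n) (mul_mem (natCast_mem _ p) hy)) fun h => ?_
  apply natCast_div_notMem (hp := hp) hn
  have : (n / p : ℚ) = x / p - y := by rw [hx]; field_simp; ring
  rw [this]
  exact sub_mem h hy

theorem natCast_inv_mem {n : ℕ} (hn : ¬ p ∣ n) : (n : ℚ)⁻¹ ∈ pIntegers p hp :=
  inv_mem_of_sub hn (zero_mem _) (by simp)

theorem pCong_iff {k : ℕ} {u v : ℚ} :
    pCong p k u v ↔ ∃ r ∈ pIntegers p hp, u = v + p ^ k * r := by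
  have hp0 : (p : ℚ) ≠ 0 := by exact_mod_cast hp.ne_zero
  constructor
  · intro h
    exact ⟨_, h, by field_simp; ring⟩
  · rintro ⟨r, hr, rfl⟩
    have : (v + p ^ k * r - v) / (p : ℚ) ^ k = r := by field_simp; ring
    rw [pCong, this]
    exact hr

theorem prod_add_mul (u : ℕ → ℚ) {s : ℚ} (hs : s ∈ pIntegers p hp) (n : ℕ)
    (hu : ∀ j < n, u j ∈ pIntegers p hp) (hu' : ∀ j < n, (u j)⁻¹ ∈ pIntegers p hp)
    (hu0 : ∀ j < n, u j ≠ 0) :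
    ∃ r ∈ pIntegers p hp, ∏ j ∈ Finset.range n, (u j + p * s) =
      (∏ j ∈ Finset.range n, u j) * (1 + p * s * ∑ j ∈ Finset.range n, (u j)⁻¹) + p ^ 2 * r := by
  induction n with
  | zero => exact ⟨0, zero_mem _, by simp⟩
  | succ n ih =>
    obtain ⟨r, hr, h⟩ := ih (fun j hj => hu j (by omega)) (fun j hj => hu' j (by omega))
      (fun j hj => hu0 j (by omega))
    have hun := hu0 n n.lt_succ_self
    have hprod : ∏ j ∈ Finset.range n, u j ∈ pIntegers p hp :=
      prod_mem fun j hj => hu j (by simp at hj; omega)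
    have hsum : ∑ j ∈ Finset.range n, (u j)⁻¹ ∈ pIntegers p hp :=
      sum_mem fun j hj => hu' j (by simp at hj; omega)
    refine ⟨s ^ 2 * (∏ j ∈ Finset.range n, u j) * (∑ j ∈ Finset.range n, (u j)⁻¹)
      + r * (u n + p * s), ?_, ?_⟩
    · exact add_mem (mul_mem (mul_mem (pow_mem hs 2) hprod) hsum)
        (mul_mem hr (add_mem (hu n n.lt_succ_self) (mul_mem (natCast_mem _ p) hs)))
    · rw [Finset.prod_range_succ, Finset.prod_range_succ, Finset.sum_range_succ, h]
      field_simp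
      ring

end pIntegers

theorem prod_range_add_succ (n : ℕ) :
    ∏ j ∈ Finset.range n, ((n + j + 1 : ℕ) : ℚ) = n.factorial * ((2 * n).choose n : ℚ) := by
  have h1 : ∏ j ∈ Finset.range n, (n + j + 1) = (n + 1).ascFactorial n := by
    rw [Nat.ascFactorial_eq_prod_range]
    exact Finset.prod_congr rfl fun j _ => by ring
  rw [← Nat.cast_prod, h1, Nat.ascFactorial_eq_factorial_mul_choose, two_mul]
  push_cast
  rfl

theorem harmonic_two_mul_sub (n : ℕ) :
    harmonic (2 * n) - harmonic n = ∑ j ∈ Finset.range n, (((n + j + 1 : ℕ) : ℚ))⁻¹ := by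
  rw [harmonic, harmonic, two_mul, Finset.sum_range_add]
  ring

theorem prod_div_factorial_congr {p : ℕ} {hp : p.Prime} {n : ℕ} (hn : 2 * n < p) {s : ℚ}
    (hs : s ∈ pIntegers p hp) :
    ∃ r ∈ pIntegers p hp, (∏ j ∈ Finset.range n, (((n + j + 1 : ℕ) : ℚ) + p * s)) / n.factorial =
      (2 * n).choose n * (1 + p * s * (harmonic (2 * n) - harmonic n)) + p ^ 2 * r := by
  obtain ⟨r, hr, h⟩ := pIntegers.prod_add_mul (fun j => ((n + j + 1 : ℕ) : ℚ)) hs n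
    (fun j _ => natCast_mem _ _)
    (fun j hj => pIntegers.natCast_inv_mem (Nat.not_dvd_of_pos_of_lt (by omega) (by omega)))
    (fun j _ => by positivity)
  have hf : ¬ p ∣ n.factorial := by rw [hp.dvd_factorial]; omega
  refine ⟨r * (n.factorial : ℚ)⁻¹, mul_mem hr (pIntegers.natCast_inv_mem hf), ?_⟩
  have hf0 : (n.factorial : ℚ) ≠ 0 := by positivity
  rw [h, prod_range_add_succ, ← harmonic_two_mul_sub]
  field_simp

/-- The product `C(x, k) * C(-1 - x, k)`. -/
def chooseProd (x : ℚ) (k : ℕ) : ℚ := rchoose x k * rchoose (-1 - x) k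

namespace chooseProd

theorem zero_right (x : ℚ) : chooseProd x 0 = 1 := by simp [chooseProd, rchoose]

theorem succ_right (x : ℚ) (k : ℕ) :
    chooseProd x (k + 1) = chooseProd x k * ((x - k) * (-1 - x - k)) / (k + 1) ^ 2 := by
  simp only [chooseProd, rchoose, Finset.prod_range_succ, Nat.factorial_succ]
  have : (k.factorial : ℚ) ≠ 0 := by positivity
  push_cast
  field_simp

theorem natCast_eq_zero {n k : ℕ} (h : n < k) : chooseProd n k = 0 := by
  have : ∏ i ∈ Finset.range k, ((n : ℚ) - i) = 0 :=
    Finset.prod_eq_zero (Finset.mem_range.2 h) (sub_self _)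
  simp [chooseProd, rchoose, this]

theorem succ_succ (x : ℚ) (k : ℕ) :
    chooseProd (x + 1) (k + 1) =
      -chooseProd x k * ((x + 1 + k) * (x + 2 + k)) / (k + 1) ^ 2 := by
  induction k with
  | zero => simp [succ_right, zero_right]; ring
  | succ k ih =>
    rw [succ_right, ih, succ_right x k]
    push_cast
    field_simp
    ring

theorem succ_left (x : ℚ) (k : ℕ) :
    (x + 1 - k) * chooseProd (x + 1) k = (x + 1 + k) * chooseProd x k := by
  cases k with
  | zero => simp [zero_right]
  | succ k =>
    rw [succ_succ, succ_right]
    push_cast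
    field_simp
    ring

theorem sum_add (x : ℚ) (hx : x + 1 ≠ 0) (m : ℕ) :
    ∑ k ∈ Finset.range (m + 1), (chooseProd (x + 1) k + chooseProd x k) =
      2 * (x + 1 + m) / (x + 1) * chooseProd x m := by
  induction m with
  | zero => simp [zero_right]; field_simp; norm_num
  | succ m ih =>
    rw [Finset.sum_range_succ, ih, succ_succ, succ_right]
    push_cast
    field_simp
    ring

theorem sum_div_add (n : ℕ) (x : ℚ) (hx : ∀ k ≤ n, x + k ≠ 0) :
    ∑ k ∈ Finset.range (n + 1), chooseProd n k / (x + k) =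
      (∏ j ∈ Finset.range n, (j + 1 - x)) / ∏ j ∈ Finset.range (n + 1), (x + j) := by
  induction n with
  | zero => simp [zero_right]
  | succ n ih =>
    have ih' := ih fun k hk => hx k (by omega)
    have h0 : x + (n + 1 : ℕ) ≠ 0 := hx _ le_rfl
    have hext : ∑ k ∈ Finset.range (n + 2), chooseProd n k / (x + k) =
        ∑ k ∈ Finset.range (n + 1), chooseProd n k / (x + k) := by
      rw [Finset.sum_range_succ, natCast_eq_zero n.lt_succ_self]
      simp
    have hdiff : (x + (n + 1 : ℕ)) * ∑ k ∈ Finset.range (n + 2), chooseProd (n + 1 : ℕ) k / (x + k)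
        - (n + 1 - x) * ∑ k ∈ Finset.range (n + 2), chooseProd n k / (x + k) = 0 := by
      have hs := sum_add n (by positivity) (n + 1)
      rw [natCast_eq_zero n.lt_succ_self, mul_zero] at hs
      rw [Finset.mul_sum, Finset.mul_sum, ← Finset.sum_sub_distrib, ← hs]
      refine Finset.sum_congr rfl fun k hk => ?_
      have hk0 := hx k (by simp at hk; omega)
      have hl := succ_left n k
      push_cast
      field_simp
      linear_combination hl
    rw [hext, ih', sub_eq_zero] at hdiff
    rw [Finset.prod_range_succ, Finset.prod_range_succ _ (n + 1), ← div_div, eq_div_iff h0,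
      mul_comm, hdiff]
    ring

theorem congr_natCast {p : ℕ} {hp : p.Prime} {n : ℕ} {t : ℚ} (ht : t ∈ pIntegers p hp) {k : ℕ}
    (hk : k < p) : chooseProd n k ∈ pIntegers p hp ∧
      ∃ r ∈ pIntegers p hp, chooseProd (n + p * t) k = chooseProd n k + p * r := by
  induction k with
  | zero => exact ⟨by simp [zero_right], 0, zero_mem _, by simp [zero_right]⟩
  | succ k ih =>
    obtain ⟨hc, r, hr, h⟩ := ih (by omega)
    have hinv : ((k + 1 : ℕ) : ℚ)⁻¹ ∈ pIntegers p hp :=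
      pIntegers.natCast_inv_mem (Nat.not_dvd_of_pos_of_lt (by omega) hk)
    have hn := natCast_mem (pIntegers p hp) n
    have hkm := natCast_mem (pIntegers p hp) k
    have hpm := natCast_mem (pIntegers p hp) p
    have hpt := mul_mem hpm ht
    have h1 := one_mem (pIntegers p hp)
    constructor
    · rw [succ_right, div_eq_mul_inv, ← inv_pow]
      refine mul_mem (mul_mem hc (mul_mem (sub_mem hn hkm)
        (sub_mem (sub_mem (neg_mem h1) hn) hkm))) (pow_mem ?_ 2)
      exact_mod_cast hinv
    · refine ⟨(r * ((n + p * t - k) * (-1 - (n + p * t) - k)) +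
        chooseProd n k * (t * (-1 - n - k) - t * (n - k) - p * t ^ 2)) *
          ((k + 1 : ℕ) : ℚ)⁻¹ ^ 2, ?_, ?_⟩
      · refine mul_mem (add_mem (mul_mem hr (mul_mem (sub_mem (add_mem hn hpt) hkm)
          (sub_mem (sub_mem (neg_mem h1) (add_mem hn hpt)) hkm))) (mul_mem hc ?_)) (pow_mem hinv 2)
        exact sub_mem (sub_mem (mul_mem ht (sub_mem (sub_mem (neg_mem h1) hn) hkm))
          (mul_mem ht (sub_mem hn hkm))) (mul_mem hpm (pow_mem ht 2))
      · rw [succ_right, succ_right, h]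
        push_cast
        field_simp
        ring

theorem add_self (n : ℕ) (s : ℚ) : chooseProd (n + s) n =
    (-1) ^ n * ((∏ j ∈ Finset.range n, (((n + j + 1 : ℕ) : ℚ) + s)) / n.factorial) *
      ((∏ j ∈ Finset.range n, (((j + 1 : ℕ) : ℚ) + s)) / n.factorial) := by
  have h1 : ∏ i ∈ Finset.range n, ((n : ℚ) + s - i) =
      ∏ j ∈ Finset.range n, (((j + 1 : ℕ) : ℚ) + s) := by
    rw [← Finset.prod_range_reflect]
    refine Finset.prod_congr rfl fun j hj => ?_
    have hj' : j + 1 ≤ n := Finset.mem_range.1 hj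
    rw [Nat.sub_sub, add_comm 1 j, Nat.cast_sub hj']
    push_cast
    ring
  have h2 : ∏ i ∈ Finset.range n, (-1 - ((n : ℚ) + s) - i) =
      (-1) ^ n * ∏ j ∈ Finset.range n, (((n + j + 1 : ℕ) : ℚ) + s) := by
    rw [← Finset.card_range n, ← Finset.prod_const, Finset.card_range, ← Finset.prod_mul_distrib]
    refine Finset.prod_congr rfl fun j _ => ?_
    push_cast
    ring
  rw [chooseProd, rchoose, rchoose, h1, h2]
  ring

theorem self (n : ℕ) : chooseProd n n = (-1) ^ n * ((2 * n).choose n : ℚ) := by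
  have h := add_self n 0
  have hf : (n.factorial : ℚ) ≠ 0 := by positivity
  have h2 : ∏ j ∈ Finset.range n, ((j + 1 : ℕ) : ℚ) = n.factorial := by
    rw [← Nat.cast_prod, Finset.prod_range_add_one_eq_factorial]
  simp only [add_zero] at h
  rw [h, prod_range_add_succ, h2]
  field_simp

end chooseProd

theorem choose_sub_one_sub_eq {p n : ℕ} (hn : 2 * n < p) :
    ((p - 1 - n).choose n : ℚ) = (-1) ^ n *
      ((∏ j ∈ Finset.range n, (((n + j + 1 : ℕ) : ℚ) + p * (-1))) / n.factorial) := by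
  have hf : (n.factorial : ℚ) ≠ 0 := by positivity
  have h := Nat.descFactorial_eq_factorial_mul_choose (p - 1 - n) n
  rw [Nat.descFactorial_eq_prod_range] at h
  have h2 : ∏ j ∈ Finset.range n, ((p - 1 - n - j : ℕ) : ℚ) =
      (-1) ^ n * ∏ j ∈ Finset.range n, (((n + j + 1 : ℕ) : ℚ) + p * (-1)) := by
    rw [← Finset.card_range n, ← Finset.prod_const, Finset.card_range, ← Finset.prod_mul_distrib]
    refine Finset.prod_congr rfl fun j hj => ?_
    have hj' := Finset.mem_range.1 hj
    rw [show p - 1 - n - j = p - (n + j + 1) by omega, Nat.cast_sub (by omega)]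
    push_cast
    ring
  rw [← Nat.cast_prod, h] at h2
  push_cast at h2 ⊢
  rw [← mul_div_assoc, eq_div_iff hf, ← h2, mul_comm]

theorem sum_chooseProd_congr {p : ℕ} {hp : p.Prime} {n : ℕ} {t : ℚ} (ht : t ∈ pIntegers p hp)
    (hnp : n < p) (ht0 : t ≠ 0) :
    ∃ r ∈ pIntegers p hp,
      ∑ k ∈ Finset.range p, chooseProd (n + p * t) k * p / (k - (n + p * t)) =
        p * ∑ k ∈ Finset.range (n + 1), chooseProd n k / (-(n + p * t) + k) -
          (chooseProd (n + p * t) n - chooseProd n n) / t + p ^ 2 * r := by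
  have hp0 : (p : ℚ) ≠ 0 := by exact_mod_cast hp.ne_zero
  have hext : ∑ k ∈ Finset.range (n + 1), chooseProd n k / (-(n + p * t) + k) =
      ∑ k ∈ Finset.range p, chooseProd n k / (-(n + p * t) + k) := by
    refine Finset.sum_subset (Finset.range_mono hnp) fun k _ hk => ?_
    rw [chooseProd.natCast_eq_zero (by simp at hk; omega), zero_div]
  have hterm : ∀ k ∈ (Finset.range p).erase n, ∃ r ∈ pIntegers p hp,
      (chooseProd (n + p * t) k - chooseProd n k) * p / (k - (n + p * t)) = p ^ 2 * r := by
    intro k hk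
    rw [Finset.mem_erase, Finset.mem_range] at hk
    obtain ⟨-, r, hr, h⟩ := chooseProd.congr_natCast (n := n) ht hk.2
    have hinv : ((k : ℚ) - (n + p * t))⁻¹ ∈ pIntegers p hp := by
      rcases lt_or_gt_of_ne hk.1 with hlt | hlt
      · rw [show (k : ℚ) - (n + p * t) = -(((n - k : ℕ) : ℚ) + p * t) by
          rw [Nat.cast_sub hlt.le]; ring, inv_neg]
        exact neg_mem (pIntegers.inv_mem_of_sub
          (Nat.not_dvd_of_pos_of_lt (by omega) (by omega)) ht rfl)
      · refine pIntegers.inv_mem_of_sub (n := k - n)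
          (Nat.not_dvd_of_pos_of_lt (by omega) (by omega)) (neg_mem ht) ?_
        rw [Nat.cast_sub hlt.le]; ring
    exact ⟨r * ((k : ℚ) - (n + p * t))⁻¹, mul_mem hr hinv, by rw [h]; ring⟩
  choose! f hf hf' using hterm
  refine ⟨∑ k ∈ (Finset.range p).erase n, f k, sum_mem hf, ?_⟩
  have hsum : ∑ k ∈ Finset.range p, (chooseProd (n + p * t) k - chooseProd n k) * p /
      (k - (n + p * t)) = p ^ 2 * ∑ k ∈ (Finset.range p).erase n, f k +
        (chooseProd (n + p * t) n - chooseProd n n) * p / (n - (n + p * t)) := by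
    rw [← Finset.sum_erase_add _ _ (Finset.mem_range.2 hnp), Finset.sum_congr rfl hf',
      ← Finset.mul_sum]
  have hn : (chooseProd (n + p * t) n - chooseProd n n) * p / (n - (n + p * t)) =
      -((chooseProd (n + p * t) n - chooseProd n n) / t) := by
    rw [sub_add_cancel_left]; field_simp
  rw [hn] at hsum
  rw [hext, Finset.mul_sum, ← sub_eq_iff_eq_add', ← sub_eq_zero]
  have hsplit : ∑ k ∈ Finset.range p, (chooseProd (n + p * t) k - chooseProd n k) * p /
      (k - (n + p * t)) = ∑ k ∈ Finset.range p, chooseProd (n + p * t) k * p / (k - (n + p * t)) -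
        ∑ k ∈ Finset.range p, p * (chooseProd n k / (-(n + p * t) + k)) := by
    rw [← Finset.sum_sub_distrib]
    refine Finset.sum_congr rfl fun k _ => ?_
    rw [neg_add_eq_sub]
    ring
  rw [hsplit] at hsum
  linear_combination hsum

theorem mul_sum_div_eq {p n : ℕ} {t : ℚ} (hp0 : (p : ℚ) ≠ 0) (ht0 : t ≠ 0)
    (h0 : ∀ j < n, ((j + 1 : ℕ) : ℚ) + p * t ≠ 0) :
    p * ∑ k ∈ Finset.range (n + 1), chooseProd n k / (-(n + p * t) + k) =
      -(-1) ^ n / t * ((∏ j ∈ Finset.range n, (((n + j + 1 : ℕ) : ℚ) + p * t)) /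
        ∏ j ∈ Finset.range n, (((j + 1 : ℕ) : ℚ) + p * t)) := by
  have h1 : ∏ j ∈ Finset.range n, (-((n : ℚ) + p * t) + j) =
      (-1) ^ n * ∏ j ∈ Finset.range n, (((j + 1 : ℕ) : ℚ) + p * t) := by
    rw [← Finset.prod_range_reflect, ← Finset.card_range n, ← Finset.prod_const,
      Finset.card_range, ← Finset.prod_mul_distrib]
    refine Finset.prod_congr rfl fun j hj => ?_
    have hj' : j + 1 ≤ n := Finset.mem_range.1 hj
    rw [Nat.sub_sub, add_comm 1 j, Nat.cast_sub hj']
    push_cast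
    ring
  have h2 : ∏ j ∈ Finset.range n, ((j : ℚ) + 1 - -(n + p * t)) =
      ∏ j ∈ Finset.range n, (((n + j + 1 : ℕ) : ℚ) + p * t) :=
    Finset.prod_congr rfl fun j _ => by push_cast; ring
  have hD : ∏ j ∈ Finset.range n, (((j + 1 : ℕ) : ℚ) + p * t) ≠ 0 :=
    Finset.prod_ne_zero_iff.2 fun j hj => h0 j (Finset.mem_range.1 hj)
  have hsq : ((-1 : ℚ) ^ n) * (-1) ^ n = 1 := by rw [← mul_pow]; simp
  rw [chooseProd.sum_div_add, Finset.prod_range_succ _ n, h1, h2,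
    show -((n : ℚ) + p * t) + n = -(p * t) by ring]
  · field_simp
    linear_combination (∏ j ∈ Finset.range n, (((n + j + 1 : ℕ) : ℚ) + p * t)) * hsq
  · intro k hk
    rcases hk.lt_or_eq with hlt | rfl
    · have h := h0 (n - k - 1) (by omega)
      rw [show n - k - 1 + 1 = n - k by omega, Nat.cast_sub hk] at h
      intro h'
      apply h
      linear_combination -h'
    · intro h'
      apply mul_ne_zero hp0 ht0
      linear_combination -h'

theorem sum_chooseProd_congr_harmonic {p : ℕ} {hp : p.Prime} {n : ℕ} {t : ℚ}
    (ht : t ∈ pIntegers p hp) (ht' : t⁻¹ ∈ pIntegers p hp) (ht0 : t ≠ 0) (hn : 2 * n < p) :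
    ∃ r ∈ pIntegers p hp,
      ∑ k ∈ Finset.range p, chooseProd (n + p * t) k * p / (k - (n + p * t)) =
        -(-1) ^ n * (2 * n).choose n * (1 / t + 2 * p * (harmonic (2 * n) - harmonic n))
          + p ^ 2 * r := by
  have hp0 : (p : ℚ) ≠ 0 := by exact_mod_cast hp.ne_zero
  have hf : ¬ p ∣ n.factorial := by rw [hp.dvd_factorial]; omega
  have hf0 : (n.factorial : ℚ) ≠ 0 := by positivity
  have hfinv := pIntegers.natCast_inv_mem (hp := hp) hf
  have hpm := natCast_mem (pIntegers p hp) p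
  have hunit : ∀ j < n, ¬ p ∣ j + 1 := fun j hj =>
    Nat.not_dvd_of_pos_of_lt (by omega) (by omega)
  obtain ⟨r₁, hr₁, h₁⟩ := sum_chooseProd_congr ht (by omega : n < p) ht0
  obtain ⟨r₂, hr₂, h₂⟩ := prod_div_factorial_congr hn ht
  obtain ⟨r₃, hr₃, h₃⟩ := pIntegers.prod_add_mul (fun j => ((j + 1 : ℕ) : ℚ)) ht n
    (fun j _ => natCast_mem _ _) (fun j hj => pIntegers.natCast_inv_mem (hunit j hj))
    (fun j _ => by positivity)
  have hfact : ∏ j ∈ Finset.range n, ((j + 1 : ℕ) : ℚ) = n.factorial := by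
    rw [← Nat.cast_prod, Finset.prod_range_add_one_eq_factorial]
  have h0 : ∀ j < n, ((j + 1 : ℕ) : ℚ) + p * t ≠ 0 := by
    intro j hj h
    apply pIntegers.natCast_div_notMem (hp := hp) (hunit j hj)
    rw [eq_neg_of_add_eq_zero_left h, ← mul_neg, mul_div_cancel_left₀ _ hp0]
    exact neg_mem ht
  have hD0 : ∏ j ∈ Finset.range n, (((j + 1 : ℕ) : ℚ) + p * t) ≠ 0 :=
    Finset.prod_ne_zero_iff.2 fun j hj => h0 j (Finset.mem_range.1 hj)
  rw [chooseProd.add_self, chooseProd.self, mul_sum_div_eq hp0 ht0 h0] at h₁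
  set N := ∏ j ∈ Finset.range n, (((n + j + 1 : ℕ) : ℚ) + p * t) with hN
  set D := ∏ j ∈ Finset.range n, (((j + 1 : ℕ) : ℚ) + p * t) with hD
  have hNmem : N ∈ pIntegers p hp :=
    prod_mem fun j _ => add_mem (natCast_mem _ _) (mul_mem hpm ht)
  obtain ⟨e, he, hDe⟩ : ∃ e ∈ pIntegers p hp, D = n.factorial + p * e := by
    refine ⟨n.factorial * t * ∑ j ∈ Finset.range n, ((j + 1 : ℕ) : ℚ)⁻¹ + p * r₃, ?_, ?_⟩
    · exact add_mem (mul_mem (mul_mem (natCast_mem _ _) ht)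
        (sum_mem fun j hj => pIntegers.natCast_inv_mem (hunit j (Finset.mem_range.1 hj))))
        (mul_mem hpm hr₃)
    · rw [h₃, hfact]; ring
  have hDinv : D⁻¹ ∈ pIntegers p hp := pIntegers.inv_mem_of_sub hf he hDe
  have hkey : N / D + N / n.factorial * (D / n.factorial) =
      2 * (N / n.factorial) + p ^ 2 * (N * e ^ 2 * D⁻¹ * (n.factorial : ℚ)⁻¹ ^ 2) := by
    have hpe : (p : ℚ) * e = D - n.factorial := by rw [hDe]; ring
    have hpe2 : (p : ℚ) ^ 2 * (N * e ^ 2 * D⁻¹ * (n.factorial : ℚ)⁻¹ ^ 2) =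
        (p * e) ^ 2 * (N * D⁻¹ * (n.factorial : ℚ)⁻¹ ^ 2) := by ring
    rw [hpe2, hpe]
    field_simp
    ring
  have hsgn : (-1 : ℚ) ^ n ∈ pIntegers p hp := pow_mem (neg_mem (one_mem _)) n
  refine ⟨r₁ - (-1) ^ n * t⁻¹ * (2 * r₂ + N * e ^ 2 * D⁻¹ * (n.factorial : ℚ)⁻¹ ^ 2), ?_, ?_⟩
  · refine sub_mem hr₁ (mul_mem (mul_mem hsgn ht') (add_mem (mul_mem (ofNat_mem _ 2) hr₂) ?_))
    exact mul_mem (mul_mem (mul_mem hNmem (pow_mem he 2)) hDinv) (pow_mem hfinv 2)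
  · rw [h₁]
    have ht1 : t * t⁻¹ = 1 := mul_inv_cancel₀ ht0
    simp only [div_eq_mul_inv _ t]
    linear_combination (-(-1) ^ n * t⁻¹) * hkey - 2 * (-1) ^ n * t⁻¹ * h₂ -
      2 * (-1) ^ n * ((2 * n).choose n) * p * (harmonic (2 * n) - harmonic n) * ht1

theorem stmt8 (p : ℕ) (hp : p.Prime) (hodd : Odd p) (a : ℚ) (A : ℕ)
    (ha : isPInt p a) (hA : A < p) (haA : pCong p 1 a (A : ℚ))
    (hA1 : 1 ≤ A) (hA2 : 2 * A < p)
    (ht : ¬ pCong p 1 ((a - A) / p) 0) :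
    pCong p 2
      (∑ k ∈ Finset.range p, rchoose a k * rchoose (-1 - a) k * (p : ℚ) / ((k : ℚ) - a))
      ((2 * ((a - A) / p) + 1) / ((a - A) / p) * (-1 : ℚ) ^ (A - 1) * ((2 * A).choose A : ℚ)
        + 2 * ((p - 1 - A).choose A : ℚ)) ∧
    pCong p 2
      ((2 * ((a - A) / p) + 1) / ((a - A) / p) * (-1 : ℚ) ^ (A - 1) * ((2 * A).choose A : ℚ)
        + 2 * ((p - 1 - A).choose A : ℚ))
      ((-1 : ℚ) ^ (A - 1) * ((2 * A).choose A : ℚ) *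
        (1 / ((a - A) / p) + 2 * (p : ℚ) * (harmonic (2 * A) - harmonic A))) := by
  have hp0 : (p : ℚ) ≠ 0 := by exact_mod_cast hp.ne_zero
  obtain ⟨n, rfl⟩ : ∃ n, A = n + 1 := ⟨A - 1, by omega⟩
  obtain ⟨t, ht_mem, rfl⟩ := (pIntegers.pCong_iff (hp := hp)).1 haA
  have hat : (((n + 1 : ℕ) : ℚ) + p ^ 1 * t - (n + 1 : ℕ)) / p = t := by field_simp; ring
  rw [hat] at ht ⊢
  rw [pow_one]
  have ht0 : t ≠ 0 := by
    rintro rfl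
    exact ht ((pIntegers.pCong_iff (hp := hp)).2 ⟨0, zero_mem _, by simp⟩)
  have htinv : t⁻¹ ∈ pIntegers p hp := by
    refine pIntegers.inv_mem ht_mem fun h => ht ?_
    exact (pIntegers.pCong_iff (hp := hp)).2 ⟨_, h, by field_simp; ring⟩
  obtain ⟨r₁, hr₁, h₁⟩ := sum_chooseProd_congr_harmonic ht_mem htinv ht0 hA2
  obtain ⟨r₂, hr₂, h₂⟩ := prod_div_factorial_congr hA2 (neg_mem (one_mem (pIntegers p hp)))
  have h₃ := choose_sub_one_sub_eq hA2
  rw [h₂] at h₃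
  have hsgn : (-1 : ℚ) ^ n ∈ pIntegers p hp := pow_mem (neg_mem (one_mem _)) n
  have hmid : (2 * t + 1) / t * (-1 : ℚ) ^ n * ((2 * (n + 1)).choose (n + 1) : ℚ)
      + 2 * ((p - 1 - (n + 1)).choose (n + 1) : ℚ) =
      (-1 : ℚ) ^ n * ((2 * (n + 1)).choose (n + 1) : ℚ) *
        (1 / t + 2 * (p : ℚ) * (harmonic (2 * (n + 1)) - harmonic (n + 1))) +
      p ^ 2 * (-2 * (-1) ^ n * r₂) := by
    rw [h₃, pow_succ]
    field_simp
    ring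
  have hmem : -2 * (-1) ^ n * r₂ ∈ pIntegers p hp :=
    mul_mem (mul_mem (neg_mem (ofNat_mem _ 2)) hsgn) hr₂
  simp only [chooseProd] at h₁
  rw [Nat.add_sub_cancel, h₁]
  refine ⟨pIntegers.pCong_iff.2 ⟨r₁ - -2 * (-1) ^ n * r₂, sub_mem hr₁ hmem, ?_⟩,
    pIntegers.pCong_iff.2 ⟨_, hmem, hmid⟩⟩
  rw [hmid, pow_succ]
  ring
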